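/- arXiv:1208.1592 — 2 statements merged into one kernel-verified Lean document; each statement's English description precedes it below -/
import Mathlib

section
/- The element −1 is not a norm in the extension ℚ(i, ζ₅)/ℚ(i): there is no a ∈ ℚ(i, ζ₅) with N_{ℚ(i,ζ₅)/ℚ(i)}(a) = −1. -/
open IntermediateField

/-- The matrix of multiplication by `x₀ + x₁ t + x₂ t² + x₃ t³` in the basis `1, t, t², t³`, where
`t⁴ + 5 t³ + 10 t² + 10 t + 5 = 0`, that is, `1 + t` is a primitive fifth root of unity. -/
def mulMatrix {R : Type*} [CommRing R] (x : Fin 4 → R) : Matrix (Fin 4) (Fin 4) R :=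
  !![x 0, -5 * x 3, -5 * x 2 + 25 * x 3, -5 * x 1 + 25 * x 2 - 75 * x 3;
     x 1, x 0 - 10 * x 3, -10 * x 2 + 45 * x 3, -10 * x 1 + 45 * x 2 - 125 * x 3;
     x 2, x 1 - 10 * x 3, x 0 - 10 * x 2 + 40 * x 3, -10 * x 1 + 40 * x 2 - 105 * x 3;
     x 3, x 2 - 5 * x 3, x 1 - 5 * x 2 + 15 * x 3, x 0 - 5 * x 1 + 15 * x 2 - 35 * x 3]

section NormForm

variable {R S : Type*} [CommRing R] [CommRing S]

/-- The remainder of the norm form `det (mulMatrix x)` after removing `x₀⁴`, divided by `5`. -/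
def normFormTail (x : Fin 4 → R) : R :=
  -x 0^3*x 1 + x 0^3*x 2 - x 0^3*x 3 + 2*x 0^2*x 1^2 - 4*x 0^2*x 1*x 2 + 4*x 0^2*x 1*x 3 +
  2*x 0^2*x 2^2 - 5*x 0^2*x 2*x 3 + 5*x 0^2*x 3^2 - 2*x 0*x 1^3 + 6*x 0*x 1^2*x 2 -
  5*x 0*x 1^2*x 3 - 5*x 0*x 1*x 2^2 + 5*x 0*x 1*x 2*x 3 + 10*x 0*x 2^2*x 3 - 30*x 0*x 2*x 3^2 +
  25*x 0*x 3^3 + x 1^4 - 5*x 1^3*x 2 + 5*x 1^3*x 3 + 10*x 1^2*x 2^2 - 20*x 1^2*x 2*x 3 +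
  10*x 1^2*x 3^2 - 10*x 1*x 2^3 + 30*x 1*x 2^2*x 3 - 25*x 1*x 2*x 3^2 + 5*x 2^4 - 25*x 2^3*x 3 +
  50*x 2^2*x 3^2 - 50*x 2*x 3^3 + 25*x 3^4

theorem det_mulMatrix (x : Fin 4 → R) :
    (mulMatrix x).det = x 0 ^ 4 + 5 * normFormTail x := by
  simp [mulMatrix, normFormTail, Matrix.det_succ_row_zero, Fin.sum_univ_succ, Fin.succAbove]
  ring

theorem det_mulMatrix_map (f : R →+* S) (x : Fin 4 → R) :
    (mulMatrix (fun i ↦ f (x i))).det = f (mulMatrix x).det := by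
  simp [det_mulMatrix, normFormTail, map_ofNat]

theorem det_mulMatrix_smul (c : R) (x : Fin 4 → R) :
    (mulMatrix (fun i ↦ c * x i)).det = c ^ 4 * (mulMatrix x).det := by
  simp only [det_mulMatrix, normFormTail]
  ring

theorem det_mulMatrix_five_mul (y a b c : R) :
    (mulMatrix ![5 * y, a, b, c]).det =
      5 * (mulMatrix ![a - 10 * y, b - 10 * y, c - 5 * y, -y]).det := by
  simp [det_mulMatrix, normFormTail]
  ring

theorem pow_mul_sum_eq_sum_mulMatrix [Algebra R S] {t : S}
    (ht : t ^ 4 + 5 * t ^ 3 + 10 * t ^ 2 + 10 * t + 5 = 0) (x : Fin 4 → R) (j : Fin 4) :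
    (∑ i : Fin 4, x i • t ^ (i : ℕ)) * t ^ (j : ℕ) =
      ∑ i : Fin 4, mulMatrix x i j • t ^ (i : ℕ) := by
  have h4 : t ^ 4 = -5 - 10 * t - 10 * t ^ 2 - 5 * t ^ 3 := by linear_combination ht
  have h5 : t ^ 5 = 25 + 45 * t + 40 * t ^ 2 + 15 * t ^ 3 := by
    linear_combination (t - 5) * ht
  have h6 : t ^ 6 = -75 - 125 * t - 105 * t ^ 2 - 35 * t ^ 3 := by
    linear_combination (t ^ 2 - 5 * t + 15) * ht
  fin_cases j <;> simp [mulMatrix, Fin.sum_univ_four, Algebra.smul_def, map_ofNat] <;> ring_nf <;>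
    (try rw [h6]) <;> (try rw [h5]) <;> (try rw [h4]) <;> ring

end NormForm

section Padic

instance fact_prime_five : Fact (Nat.Prime 5) := ⟨by norm_num⟩

theorem five_dvd_iff_toZMod (x : ℤ_[5]) : 5 ∣ x ↔ PadicInt.toZMod x = 0 := by
  rw [← RingHom.mem_ker, PadicInt.ker_toZMod, PadicInt.maximalIdeal_eq_span_p,
    Ideal.mem_span_singleton]
  norm_num

theorem five_dvd_of_pow_four_add_pow_four {x d c : ℤ_[5]} (h : x ^ 4 + d ^ 4 = 5 * c) :
    5 ∣ x ∧ 5 ∣ d := by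
  have key : ∀ u v : ZMod 5, u ^ 4 + v ^ 4 = 0 → u = 0 ∧ v = 0 := by decide
  rw [five_dvd_iff_toZMod, five_dvd_iff_toZMod]
  apply key
  rw [← map_pow, ← map_pow, ← map_add, h, ← five_dvd_iff_toZMod]
  exact dvd_mul_right _ _

theorem exists_five_mul_of_det_mulMatrix_eq {a b c d e : ℤ_[5]}
    (h : (mulMatrix ![a, b, c, d]).det = 5 * e) :
    ∃ y, a = 5 * y ∧ (mulMatrix ![b - 10 * y, c - 10 * y, d - 5 * y, -y]).det = e := by
  obtain ⟨y, rfl⟩ : 5 ∣ a := by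
    refine (five_dvd_of_pow_four_add_pow_four (d := 0)
      (c := e - normFormTail ![a, b, c, d]) ?_).1
    rw [det_mulMatrix] at h
    simp only [Matrix.cons_val_zero] at h
    linear_combination h
  rw [det_mulMatrix_five_mul] at h
  exact ⟨y, rfl, mul_left_cancel₀ (by norm_num) h⟩

theorem exists_descent {x : Fin 4 → ℤ_[5]} {d : ℤ_[5]} (h : (mulMatrix x).det + d ^ 4 = 0) :
    ∃ (y : Fin 4 → ℤ_[5]) (e : ℤ_[5]), (∀ i, x i = 5 * y i) ∧ d = 5 * e ∧
      (mulMatrix y).det + e ^ 4 = 0 := by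
  obtain ⟨e, rfl⟩ : 5 ∣ d := by
    refine (five_dvd_of_pow_four_add_pow_four (x := x 0) (c := -normFormTail x) ?_).2
    rw [det_mulMatrix] at h
    linear_combination h
  have hx : x = ![x 0, x 1, x 2, x 3] := by ext i; fin_cases i <;> rfl
  have h0 : (mulMatrix ![x 0, x 1, x 2, x 3]).det = 5 * (5 * (5 * (5 * -e ^ 4))) := by
    rw [← hx]
    linear_combination h
  obtain ⟨y₀, e₀, h₁⟩ := exists_five_mul_of_det_mulMatrix_eq h0
  obtain ⟨y₁, e₁, h₂⟩ := exists_five_mul_of_det_mulMatrix_eq h₁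
  obtain ⟨y₂, e₂, h₃⟩ := exists_five_mul_of_det_mulMatrix_eq h₂
  obtain ⟨y₃, e₃, -⟩ := exists_five_mul_of_det_mulMatrix_eq h₃
  have hy : ∃ y : Fin 4 → ℤ_[5], ∀ i, x i = 5 * y i := by
    refine ⟨![y₀, y₁ + 2 * y₀, y₂ + 2 * y₁ + 2 * y₀, y₃ + 2 * y₂ + 2 * y₁ + y₀], fun i ↦ ?_⟩
    fin_cases i <;> simp
    · exact e₀
    · linear_combination e₁
    · linear_combination e₂
    · linear_combination e₃
  obtain ⟨y, hy⟩ := hy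
  refine ⟨y, e, hy, rfl, ?_⟩
  rw [funext hy, det_mulMatrix_smul] at h
  exact mul_left_cancel₀ (a := (5 : ℤ_[5]) ^ 4) (by norm_num) (by linear_combination h)

theorem padicInt_eq_zero_of_det_mulMatrix_add_pow_four {x : Fin 4 → ℤ_[5]} {d : ℤ_[5]}
    (h : (mulMatrix x).det + d ^ 4 = 0) : (∀ i, x i = 0) ∧ d = 0 := by
  have key : ∀ (n : ℕ) (x : Fin 4 → ℤ_[5]) (d : ℤ_[5]), (mulMatrix x).det + d ^ 4 = 0 →
      (∀ i, 5 ^ n ∣ x i) ∧ 5 ^ n ∣ d := by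
    intro n
    induction n with
    | zero => simp
    | succ n ih =>
      intro x d h
      obtain ⟨y, e, hy, rfl, h'⟩ := exists_descent h
      obtain ⟨h₁, h₂⟩ := ih y e h'
      rw [pow_succ']
      exact ⟨fun i ↦ hy i ▸ mul_dvd_mul_left 5 (h₁ i), mul_dvd_mul_left 5 h₂⟩
  have hprime : Prime (5 : ℤ_[5]) := by exact_mod_cast PadicInt.prime_p (p := 5)
  have hzero : ∀ z : ℤ_[5], (∀ n, 5 ^ n ∣ z) → z = 0 := by
    intro z hz
    by_contra hne
    obtain ⟨n, hn⟩ := FiniteMultiplicity.of_not_isUnit hprime.not_isUnit hne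
    exact hn (hz _)
  exact ⟨fun i ↦ hzero _ fun n ↦ (key n x d h).1 i, hzero _ fun n ↦ (key n x d h).2⟩

theorem padic_eq_zero_of_det_mulMatrix_add_pow_four {x : Fin 4 → ℚ_[5]} {d : ℚ_[5]}
    (h : (mulMatrix x).det + d ^ 4 = 0) : (∀ i, x i = 0) ∧ d = 0 := by
  obtain ⟨⟨c, hc⟩, hint⟩ := IsLocalization.exist_integer_multiples_of_finite
    (nonZeroDivisors ℤ_[5]) (fun i : Option (Fin 4) ↦ i.elim d x)
  choose v hv using hint
  have hc0 : algebraMap ℤ_[5] ℚ_[5] c ≠ 0 := by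
    simpa using nonZeroDivisors.ne_zero hc
  simp only [Algebra.smul_def] at hv
  have hx : ∀ i, algebraMap ℤ_[5] ℚ_[5] (v (some i)) = algebraMap ℤ_[5] ℚ_[5] c * x i :=
    fun i ↦ hv (some i)
  have hd : algebraMap ℤ_[5] ℚ_[5] (v none) = algebraMap ℤ_[5] ℚ_[5] c * d := hv none
  have hv' : (mulMatrix fun i ↦ v (some i)).det + v none ^ 4 = 0 := by
    apply FaithfulSMul.algebraMap_injective ℤ_[5] ℚ_[5]
    rw [map_add, map_pow, map_zero, ← det_mulMatrix_map, funext hx, hd, det_mulMatrix_smul]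
    linear_combination (algebraMap ℤ_[5] ℚ_[5] c) ^ 4 * h
  obtain ⟨h₁, h₂⟩ := padicInt_eq_zero_of_det_mulMatrix_add_pow_four hv'
  refine ⟨fun i ↦ ?_, ?_⟩
  · have := hx i
    rw [h₁, map_zero] at this
    exact (mul_eq_zero.1 this.symm).resolve_left hc0
  · rw [h₂, map_zero] at hd
    exact (mul_eq_zero.1 hd.symm).resolve_left hc0

theorem exists_sq_eq_neg_one_padicInt_five : ∃ z : ℤ_[5], z ^ 2 = -1 := by
  have hF : ‖(5 : ℤ_[5])‖ < 1 := by
    simpa using PadicInt.norm_int_lt_one_iff_dvd (p := 5) 5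
  have h4 : ‖(4 : ℤ_[5])‖ = 1 := by
    have h : ¬ ‖((4 : ℤ) : ℤ_[5])‖ < 1 := by
      rw [PadicInt.norm_int_lt_one_iff_dvd]
      norm_num
    exact le_antisymm (PadicInt.norm_le_one _) (by simpa using h)
  obtain ⟨z, hz, -⟩ := hensels_lemma (p := 5) (F := (Polynomial.X ^ 2 + 1 : Polynomial ℤ_[5]))
    (a := 2) (by
      simp only [Polynomial.derivative_add, Polynomial.derivative_X_pow, Polynomial.derivative_one]
      norm_num [h4, hF])
  exact ⟨z, by simpa [add_eq_zero_iff_eq_neg] using hz⟩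

theorem nonempty_adjoin_I_ringHom_padic : Nonempty (ℚ⟮Complex.I⟯ →+* ℚ_[5]) := by
  have hI : IsIntegral ℚ Complex.I := Complex.isIntegral_rat_I
  obtain ⟨z, hz⟩ := exists_sq_eq_neg_one_padicInt_five
  have hmin : minpoly ℚ Complex.I = Polynomial.X ^ 2 + 1 := by
    have h := Polynomial.cyclotomic_eq_minpoly_rat Complex.isPrimitiveRoot_I (by norm_num)
    rw [← h, show (4 : ℕ) = 2 ^ (1 + 1) by norm_num,
      Polynomial.cyclotomic_prime_pow_eq_geom_sum Nat.prime_two]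
    simp [Finset.sum_range_succ, add_comm]
  refine ⟨((algHomAdjoinIntegralEquiv ℚ hI).symm ⟨(z : ℚ_[5]), ?_⟩).toRingHom⟩
  rw [hmin, Polynomial.mem_aroots]
  refine ⟨hmin ▸ minpoly.ne_zero hI, ?_⟩
  have : (z : ℚ_[5]) ^ 2 = -1 := by exact_mod_cast congrArg ((↑) : ℤ_[5] → ℚ_[5]) hz
  simp [this]

end Padic

theorem eq_zero_of_det_mulMatrix_add_pow_four {x : Fin 4 → ℚ⟮Complex.I⟯} {d : ℚ⟮Complex.I⟯}
    (h : (mulMatrix x).det + d ^ 4 = 0) : (∀ i, x i = 0) ∧ d = 0 := by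
  obtain ⟨f⟩ := nonempty_adjoin_I_ringHom_padic
  have := padic_eq_zero_of_det_mulMatrix_add_pow_four (x := fun i ↦ f (x i)) (d := f d) (by
    rw [det_mulMatrix_map, ← map_pow, ← map_add, h, map_zero])
  simpa using this

theorem linearIndependent_pow_of_det_mulMatrix_ne_zero {F K : Type*} [Field F] [Field K]
    [Algebra F K] (hF : ∀ x : Fin 4 → F, (mulMatrix x).det = 0 → ∀ i, x i = 0) {t : K}
    (ht : t ^ 4 + 5 * t ^ 3 + 10 * t ^ 2 + 10 * t + 5 = 0) :
    LinearIndependent F (fun i : Fin 4 ↦ t ^ (i : ℕ)) := by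
  rw [Fintype.linearIndependent_iff]
  intro g hg
  apply hF
  apply FaithfulSMul.algebraMap_injective F K
  rw [map_zero, RingHom.map_det, ← Matrix.exists_vecMul_eq_zero_iff]
  refine ⟨fun i : Fin 4 ↦ t ^ (i : ℕ), fun h ↦ by simpa using congrFun h 0, ?_⟩
  ext j
  have := pow_mul_sum_eq_sum_mulMatrix ht g j
  rw [hg, zero_mul] at this
  simpa [Matrix.vecMul, dotProduct, Algebra.smul_def, mul_comm] using this.symm

theorem exists_norm_eq_det_mulMatrix {F K : Type*} [Field F] [Field K]
    [Algebra F K] (hF : ∀ x : Fin 4 → F, (mulMatrix x).det = 0 → ∀ i, x i = 0) {t : K}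
    (ht : t ^ 4 + 5 * t ^ 3 + 10 * t ^ 2 + 10 * t + 5 = 0) [FiniteDimensional F K]
    (hrank : Module.finrank F K ≤ 4) (a : K) :
    ∃ x : Fin 4 → F, Algebra.norm F a = (mulMatrix x).det := by
  have hli := linearIndependent_pow_of_det_mulMatrix_ne_zero hF ht
  have hcard : Fintype.card (Fin 4) = Module.finrank F K :=
    le_antisymm hli.fintype_card_le_finrank (by simpa using hrank)
  set b := basisOfLinearIndependentOfCardEqFinrank hli hcard
  have hb : ∀ i, b i = t ^ (i : ℕ) := fun i ↦ by simp [b]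
  refine ⟨b.repr a, ?_⟩
  rw [Algebra.norm_eq_matrix_det b]
  congr 1
  ext i j
  have h := pow_mul_sum_eq_sum_mulMatrix ht (b.repr a) j
  simp only [← hb, b.sum_repr] at h
  rw [Algebra.leftMulMatrix_eq_repr_mul, h, b.repr_sum_self]

/-- `-1` is not a norm in the extension `ℚ(i, ζ₅)/ℚ(i)`: there is no
`a ∈ ℚ(i, ζ₅)` with `N_{ℚ(i,ζ₅)/ℚ(i)}(a) = -1`. -/
theorem statement_4 (ζ : ℂ) (hζ : IsPrimitiveRoot ζ 5)
    (a : ℚ⟮Complex.I⟯⟮ζ⟯) :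
    Algebra.norm ℚ⟮Complex.I⟯ a ≠ -1 := by
  intro ha
  have hint : IsIntegral ℚ⟮Complex.I⟯ ζ := (hζ.isIntegral (by norm_num)).tower_top
  have hsum : 1 + ζ + ζ ^ 2 + ζ ^ 3 + ζ ^ 4 = 0 := by
    simpa [Finset.sum_range_succ] using hζ.geom_sum_eq_zero (by norm_num)
  have := adjoin.finiteDimensional hint
  have hrank : Module.finrank ℚ⟮Complex.I⟯ ℚ⟮Complex.I⟯⟮ζ⟯ ≤ 4 := by
    rw [adjoin.finrank hint]
    have hdeg : (Polynomial.cyclotomic 5 ℚ⟮Complex.I⟯).natDegree = 4 := by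
      rw [Polynomial.natDegree_cyclotomic]
      decide
    rw [← hdeg]
    refine Polynomial.natDegree_le_of_dvd (minpoly.dvd _ _ ?_) (Polynomial.cyclotomic_ne_zero _ _)
    rw [Polynomial.aeval_def, Polynomial.eval₂_eq_eval_map, Polynomial.map_cyclotomic]
    exact hζ.isRoot_cyclotomic (by norm_num)
  have ht : (AdjoinSimple.gen ℚ⟮Complex.I⟯ ζ - 1) ^ 4 + 5 * (AdjoinSimple.gen ℚ⟮Complex.I⟯ ζ - 1) ^ 3
      + 10 * (AdjoinSimple.gen ℚ⟮Complex.I⟯ ζ - 1) ^ 2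
      + 10 * (AdjoinSimple.gen ℚ⟮Complex.I⟯ ζ - 1) + 5 = 0 := by
    apply FaithfulSMul.algebraMap_injective ℚ⟮Complex.I⟯⟮ζ⟯ ℂ
    simp only [map_add, map_mul, map_pow, map_sub, map_one, map_ofNat, map_zero,
      AdjoinSimple.algebraMap_gen]
    linear_combination hsum
  obtain ⟨x, hx⟩ := exists_norm_eq_det_mulMatrix
    (fun x hx ↦ (eq_zero_of_det_mulMatrix_add_pow_four (d := 0) (by simpa using hx)).1) ht hrank a
  have h := (eq_zero_of_det_mulMatrix_add_pow_four (x := x) (d := 1) (by rw [← hx, ha]; ring)).2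
  exact one_ne_zero h
end

section
/- The element −1 is not a norm in the extension ℚ(ω, ζ₇)/ℚ(ω): there is no a ∈ ℚ(ω, ζ₇) with N_{ℚ(ω,ζ₇)/ℚ(ω)}(a) = −1. -/
open IntermediateField

/-- The companion matrix of the seventh cyclotomic polynomial. -/
def cyclotomicSevenCompanion : Matrix (Fin 6) (Fin 6) ℤ :=
  !![0, 0, 0, 0, 0, -1; 1, 0, 0, 0, 0, -1; 0, 1, 0, 0, 0, -1;
     0, 0, 1, 0, 0, -1; 0, 0, 0, 1, 0, -1; 0, 0, 0, 0, 1, -1]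

/-- The matrix of multiplication by `ζ₇ - 1` in the basis `1, ζ₇, …, ζ₇⁵`. -/
def uniformizerMatrix (R : Type*) [CommRing R] : Matrix (Fin 6) (Fin 6) R :=
  (Int.castRingHom R).mapMatrix (cyclotomicSevenCompanion - 1)

open Polynomial in
/-- The norm of `g(ζ₇ - 1)`, written as a determinant over the ring of coefficients of `g`. -/
noncomputable def normForm {R : Type*} [CommRing R] (g : R[X]) : R :=
  (aeval (uniformizerMatrix R) g).det

instance fact_prime_seven : Fact (Nat.Prime 7) := ⟨by norm_num⟩

section NormForm

open Polynomial

variable {R S : Type*} [CommRing R] [CommRing S]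

lemma normForm_mul (f g : R[X]) : normForm (f * g) = normForm f * normForm g := by
  simp [normForm]

lemma normForm_pow (f : R[X]) (n : ℕ) : normForm (f ^ n) = normForm f ^ n := by
  simp [normForm]

lemma normForm_C (c : R) : normForm (C c) = c ^ 6 := by
  simp [normForm, Algebra.algebraMap_eq_smul_one]

lemma mapMatrix_uniformizerMatrix (f : R →+* S) :
    f.mapMatrix (uniformizerMatrix R) = uniformizerMatrix S := by
  ext i j
  simp [uniformizerMatrix]

lemma normForm_map (f : R →+* S) (g : R[X]) : normForm (g.map f) = f (normForm g) := by
  rw [normForm, normForm, RingHom.map_det, aeval_def, aeval_def, hom_eval₂, eval₂_map,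
    mapMatrix_uniformizerMatrix]
  congr 2
  ext x i j
  simp [Matrix.algebraMap_matrix_apply, apply_ite f]

lemma normForm_X : normForm (X : R[X]) = 7 := by
  have h : (cyclotomicSevenCompanion - 1).det = 7 := by
    simp [cyclotomicSevenCompanion, Matrix.det_succ_row_zero, Fin.sum_univ_succ,
      Matrix.one_apply, Fin.succAbove]
  rw [normForm, aeval_X, uniformizerMatrix, ← RingHom.map_det, h]
  simp

/-- The polynomial `(∑ i < 7, (X + 1) ^ i - X ^ 6) / 7`. -/
noncomputable def eisensteinTail (R : Type*) [CommRing R] : R[X] :=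
  X ^ 5 + 3 * X ^ 4 + 5 * X ^ 3 + 5 * X ^ 2 + 3 * X + 1

lemma uniformizerMatrix_relation :
    aeval (uniformizerMatrix R) (X ^ 6 + 7 * eisensteinTail R) = 0 := by
  have h : ∑ i ∈ Finset.range 7, cyclotomicSevenCompanion ^ i = 0 := by decide
  have h2 := congrArg (Int.castRingHom R).mapMatrix h
  rw [map_sum, map_zero] at h2
  have h3 : (Int.castRingHom R).mapMatrix cyclotomicSevenCompanion
      = aeval (uniformizerMatrix R) (X + 1 : R[X]) := by
    rw [uniformizerMatrix, map_add, aeval_X, map_one, map_sub, map_one, sub_add_cancel]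
  have hpoly : X ^ 6 + 7 * eisensteinTail R = ∑ i ∈ Finset.range 7, (X + 1) ^ i := by
    simp only [eisensteinTail, Finset.sum_range_succ, Finset.sum_range_zero]
    ring
  rw [hpoly, map_sum, ← h2]
  simp only [map_pow, h3]

lemma normForm_add_mul (f g : R[X]) :
    normForm (f + g * (X ^ 6 + 7 * eisensteinTail R)) = normForm f := by
  simp only [normForm, map_add (aeval (uniformizerMatrix R)) f, map_mul _ g,
    uniformizerMatrix_relation, mul_zero, add_zero]

lemma normForm_zmod (g : (ZMod 7)[X]) : normForm g = g.coeff 0 ^ 6 := by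
  set M := uniformizerMatrix (ZMod 7)
  have hM : M ^ 6 = 0 := by
    have := uniformizerMatrix_relation (R := ZMod 7)
    rw [show (7 : (ZMod 7)[X]) = 0 from CharP.cast_eq_zero (ZMod 7)[X] 7] at this
    simpa using this
  have hN : IsNilpotent (-aeval M (X * g.divX)) := by
    refine ⟨6, ?_⟩
    rw [neg_pow, ← map_pow, mul_pow, map_mul, map_pow, aeval_X, hM, zero_mul, mul_zero]
  have h := (Matrix.isNilpotent_charpoly_sub_pow_of_isNilpotent hN).eq_zero
  rw [sub_eq_zero] at h
  have h2 := congrArg (eval (g.coeff 0)) h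
  rw [Matrix.eval_charpoly] at h2
  simp only [eval_pow, eval_X, Fintype.card_fin, sub_neg_eq_add] at h2
  rw [← h2, normForm]
  conv_lhs => rw [← X_mul_divX_add g]
  rw [map_add, aeval_C, add_comm]
  rfl

end NormForm

section Padic

open Polynomial

lemma PadicInt.toZMod_eq_zero_iff_dvd {p : ℕ} [Fact p.Prime] (x : ℤ_[p]) :
    PadicInt.toZMod x = 0 ↔ (p : ℤ_[p]) ∣ x := by
  rw [← RingHom.mem_ker, PadicInt.ker_toZMod, PadicInt.maximalIdeal_eq_span_p,
    Ideal.mem_span_singleton]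

lemma toZMod_seven : PadicInt.toZMod (7 : ℤ_[7]) = 0 :=
  (PadicInt.toZMod_eq_zero_iff_dvd _).2 (dvd_of_eq (by norm_num))

lemma C_seven_dvd_of_map_eq_zero {q : ℤ_[7][X]} (h : q.map PadicInt.toZMod = 0) :
    C 7 ∣ q := by
  rw [C_dvd_iff_dvd_coeff]
  intro i
  have := congrArg (coeff · i) h
  simp only [coeff_map, coeff_zero] at this
  simpa using (PadicInt.toZMod_eq_zero_iff_dvd _).1 this

lemma toZMod_normForm (g : ℤ_[7][X]) :
    PadicInt.toZMod (normForm g) = PadicInt.toZMod (g.coeff 0) ^ 6 := by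
  rw [← normForm_map, normForm_zmod, coeff_map]

/-- A polynomial of degree less than `6` that is nonzero modulo `7` has value at `ζ₇ - 1` equal
to a power of `ζ₇ - 1` times a unit. -/
lemma exists_normForm_mul_eq {q : ℤ_[7][X]} (hq : q.map PadicInt.toZMod ≠ 0)
    (hdeg : q.natDegree < 6) :
    ∃ j < 6, ∃ w u : ℤ_[7], PadicInt.toZMod w = 1 ∧ PadicInt.toZMod u = 1 ∧
      normForm q * w = 7 ^ j * u := by
  obtain ⟨c, hc, hXc⟩ := (finiteMultiplicity_of_degree_pos_of_monic (p := X)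
    (by simp) monic_X hq).exists_eq_pow_mul_and_not_dvd
  set j := multiplicity X (q.map PadicInt.toZMod)
  obtain ⟨r, rfl⟩ := map_surjective _ (ZMod.ringHom_surjective (PadicInt.toZMod (p := 7))) c
  have hj : j < 6 := by
    have := natDegree_le_of_dvd (Dvd.intro _ hc.symm) hq
    rw [natDegree_X_pow] at this
    exact (this.trans natDegree_map_le).trans_lt hdeg
  have hr : PadicInt.toZMod (r.coeff 0) ≠ 0 := by
    rwa [X_dvd_iff, coeff_map] at hXc
  obtain ⟨s, hs⟩ : C 7 ∣ q - X ^ j * r :=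
    C_seven_dvd_of_map_eq_zero (by rw [Polynomial.map_sub, hc]; simp)
  refine ⟨j, hj, normForm (eisensteinTail _),
    normForm (r * eisensteinTail _ - X ^ (6 - j) * s), ?_, ?_, ?_⟩
  · rw [toZMod_normForm]
    simp [eisensteinTail, coeff_one]
  · rw [toZMod_normForm]
    have : (r * eisensteinTail _ - X ^ (6 - j) * s).coeff 0 = r.coeff 0 := by
      have : 6 - j ≠ 0 := by omega
      simp [eisensteinTail, mul_coeff_zero, this.symm]
    rw [this]
    exact ZMod.pow_card_sub_one_eq_one hr
  · rw [← normForm_X, ← normForm_pow, ← normForm_mul, ← normForm_mul,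
      ← normForm_add_mul (X ^ j * _) s]
    congr 1
    have h6 : (X : ℤ_[7][X]) ^ 6 = X ^ j * X ^ (6 - j) := by
      rw [← pow_add]; congr 1; omega
    have h7 : (C 7 : ℤ_[7][X]) = 7 := rfl
    rw [sub_eq_iff_eq_add, h7] at hs
    rw [hs, h6]
    ring

lemma normForm_ne_neg_pow (k : ℕ) {u : ℤ_[7]} (hu : PadicInt.toZMod u ≠ 0) {q : ℤ_[7][X]}
    (hdeg : q.natDegree < 6) : normForm q ≠ -(u * 7 ^ k) ^ 6 := by
  have h7 : (7 : ℤ_[7]) ≠ 0 := by norm_num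
  have hu6 : PadicInt.toZMod u ^ 6 = 1 := ZMod.pow_card_sub_one_eq_one hu
  induction k generalizing q with
  | zero =>
    intro h
    by_cases hq : q.map PadicInt.toZMod = 0
    · have := congrArg PadicInt.toZMod h
      rw [← normForm_map, hq] at this
      simp [normForm_zmod, hu] at this
    · obtain ⟨j, hj, w, v, hw, hv, h2⟩ := exists_normForm_mul_eq hq hdeg
      rw [h] at h2
      have := congrArg PadicInt.toZMod h2
      simp only [pow_zero, mul_one, map_mul, map_neg, map_pow, hw, hv, hu6, toZMod_seven] at this
      rcases Nat.eq_zero_or_pos j with rfl | hj0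
      · revert this; decide
      · rw [zero_pow hj0.ne'] at this
        revert this; decide
  | succ k ih =>
    intro h
    by_cases hq : q.map PadicInt.toZMod = 0
    · obtain ⟨q', rfl⟩ := C_seven_dvd_of_map_eq_zero hq
      rw [natDegree_C_mul h7] at hdeg
      apply ih hdeg
      rw [normForm_mul, normForm_C] at h
      apply mul_left_cancel₀ (pow_ne_zero 6 h7)
      rw [h]
      ring
    · obtain ⟨j, hj, w, v, hw, hv, h2⟩ := exists_normForm_mul_eq hq hdeg
      have h3 : 7 ^ j * (7 * (7 ^ (5 - j) * -(u * 7 ^ k) ^ 6 * w)) = 7 ^ j * v := by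
        rw [← h2, h]
        have : (7 : ℤ_[7]) ^ 6 = 7 ^ j * (7 * 7 ^ (5 - j)) := by
          rw [← pow_succ', ← pow_add]; congr 1; omega
        rw [pow_succ 7 k, ← mul_assoc u, mul_pow _ (7 : ℤ_[7]) 6, this]
        ring
      have := congrArg PadicInt.toZMod (mul_left_cancel₀ (pow_ne_zero j h7) h3)
      rw [map_mul, toZMod_seven, zero_mul, hv] at this
      exact zero_ne_one this

lemma padic_normForm_ne_neg_one {q : ℚ_[7][X]} (hdeg : q.natDegree < 6) : normForm q ≠ -1 := by
  intro h
  obtain ⟨b, hb, hbq⟩ := IsLocalization.integerNormalization_spec (nonZeroDivisors ℤ_[7]) q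
  have hb0 : b ≠ 0 := nonZeroDivisors.ne_zero hb
  set r := IsLocalization.integerNormalization (nonZeroDivisors ℤ_[7]) q
  have hinj : Function.Injective (algebraMap ℤ_[7] ℚ_[7]) := IsFractionRing.injective _ _
  have hr : b • q = C (algebraMap ℤ_[7] ℚ_[7] b) * q := by
    ext i
    simp [Algebra.smul_def]
  rw [hr] at hbq
  have hrdeg : r.natDegree < 6 := by
    rw [← natDegree_map_eq_of_injective hinj, hbq]
    exact (natDegree_C_mul_le _ _).trans_lt hdeg
  have hu : PadicInt.toZMod (PadicInt.unitCoeff hb0 : ℤ_[7]) ≠ 0 :=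
    ((PadicInt.unitCoeff hb0).isUnit.map PadicInt.toZMod).ne_zero
  apply normForm_ne_neg_pow b.valuation hu hrdeg
  apply hinj
  have h7 : ((7 : ℕ) : ℤ_[7]) = 7 := by norm_num
  rw [← h7, ← PadicInt.unitCoeff_spec hb0, ← normForm_map, hbq, normForm_mul, normForm_C, h]
  simp

lemma irreducible_cyclotomic_padic (p : ℕ) [Fact p.Prime] :
    Irreducible (cyclotomic p ℚ_[p]) := by
  set f := (cyclotomic p ℤ_[p]).comp (X + 1) with hf
  have hmap : f = ((cyclotomic p ℤ).comp (X + 1)).map (algebraMap ℤ ℤ_[p]) := by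
    simp [hf, Polynomial.map_comp]
  have hmonic : f.Monic := (cyclotomic.monic p _).comp_X_add_C 1
  have hmonicℤ : ((cyclotomic p ℤ).comp (X + 1)).Monic := (cyclotomic.monic p _).comp_X_add_C 1
  have hdeg : f.natDegree = p - 1 := by
    rw [hf, natDegree_comp, natDegree_cyclotomic, Nat.totient_prime Fact.out, ← C_1,
      natDegree_X_add_C, mul_one]
  have hE : f.IsEisensteinAt (Ideal.span {(p : ℤ_[p])}) := by
    have h := cyclotomic_comp_X_add_one_isEisensteinAt p
    refine ⟨?_, ?_, ?_⟩
    · rw [hmonic.leadingCoeff, Ideal.mem_span_singleton]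
      exact fun h => PadicInt.prime_p.not_isUnit (isUnit_of_dvd_one h)
    · intro n hn
      rw [hmap, hmonicℤ.natDegree_map] at hn
      have hc := Ideal.mem_span_singleton.1 (h.mem hn)
      rw [hmap, coeff_map, Ideal.mem_span_singleton]
      simpa using map_dvd (algebraMap ℤ ℤ_[p]) hc
    · rw [Ideal.span_singleton_pow, Ideal.mem_span_singleton, coeff_zero_eq_eval_zero, hf,
        eval_comp, eval_add, eval_X, eval_one, zero_add, eval_one_cyclotomic_prime, pow_two]
      intro h
      have h0 := PadicInt.prime_p (p := p).ne_zero
      exact PadicInt.prime_p.not_isUnit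
        (isUnit_of_dvd_one ((mul_dvd_mul_iff_left h0).1 (by rwa [mul_one])))
  have hirr := hE.irreducible ((Ideal.span_singleton_prime PadicInt.prime_p.ne_zero).2
    PadicInt.prime_p) hmonic.isPrimitive (by
      rw [hdeg]; have := (Fact.out : p.Prime).two_le; omega)
  have hcomp : f = algEquivAevalXAddC (1 : ℤ_[p]) (cyclotomic p ℤ_[p]) := by
    simp [hf, comp, aeval_def]
  rw [hcomp, MulEquiv.irreducible_iff] at hirr
  simpa using ((cyclotomic.monic p ℤ_[p]).irreducible_iff_irreducible_map_fraction_map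
    (K := ℚ_[p])).1 hirr

lemma exists_padic_cube_root : ∃ z : ℤ_[7], z ^ 2 + z + 1 = 0 := by
  have h5 : ‖(5 : ℤ_[7])‖ = 1 := by
    rw [← PadicInt.isUnit_iff]
    by_contra h
    rw [← mem_nonunits_iff, ← IsLocalRing.mem_maximalIdeal, ← PadicInt.ker_toZMod,
      RingHom.mem_ker, map_ofNat] at h
    exact absurd h (by decide)
  have h7 : ‖(7 : ℤ_[7])‖ < 1 := by
    have := PadicInt.norm_p (p := 7)
    rw [show (7 : ℤ_[7]) = ((7 : ℕ) : ℤ_[7]) by norm_num, this]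
    norm_num
  obtain ⟨z, hz, -⟩ := hensels_lemma (p := 7) (F := (X ^ 2 + X + 1 : ℤ_[7][X])) (a := 2) (by
    have e1 : aeval (2 : ℤ_[7]) (X ^ 2 + X + 1 : ℤ_[7][X]) = 7 := by simp; norm_num
    have e2 : aeval (2 : ℤ_[7]) (derivative (X ^ 2 + X + 1 : ℤ_[7][X])) = 5 := by simp; norm_num
    rw [e1, e2, h5]
    simpa using h7)
  exact ⟨z, by simpa using hz⟩

lemma exists_ringHom_padic {ω : ℂ} (hω : IsPrimitiveRoot ω 3) :
    Nonempty (ℚ⟮ω⟯ →+* ℚ_[7]) := by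
  obtain ⟨z, hz⟩ := exists_padic_cube_root
  have hmin := cyclotomic_eq_minpoly_rat hω (by norm_num)
  have hint : IsIntegral ℚ ω := hω.isIntegral (by norm_num) |>.tower_top
  refine ⟨((algHomAdjoinIntegralEquiv ℚ hint).symm ⟨(z : ℚ_[7]), ?_⟩).toRingHom⟩
  rw [mem_aroots, ← hmin]
  refine ⟨cyclotomic_ne_zero 3 ℚ, ?_⟩
  rw [cyclotomic_three]
  simpa using congrArg (algebraMap ℤ_[7] ℚ_[7]) hz

end Padic

section Norm

open Polynomial

lemma norm_eq_normForm {F K : Type*} [Field F] [Field K] [Algebra F K] (pb : PowerBasis F K)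
    (hmin : minpoly F pb.gen = cyclotomic 7 F) (g : F[X]) :
    Algebra.norm F (aeval (pb.gen - 1) g) = normForm g := by
  have hdim : pb.dim = 6 := by
    rw [← pb.natDegree_minpoly, hmin, natDegree_cyclotomic, Nat.totient_prime Fact.out]
  set b := pb.basis.reindex (finCongr hdim) with hb
  have hbj (j : Fin 6) : b j = pb.gen ^ (j : ℕ) := by simp [hb]
  have hgen : ∑ i ∈ Finset.range 7, pb.gen ^ i = 0 := by
    have := minpoly.aeval F pb.gen
    rw [hmin, cyclotomic_prime] at this
    simpa using this
  have hC : Algebra.leftMulMatrix b pb.gen =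
      (Int.castRingHom F).mapMatrix cyclotomicSevenCompanion := by
    have key (j : Fin 6) : pb.gen * b j =
        ∑ i, (Int.castRingHom F (cyclotomicSevenCompanion i j)) • b i := by
      simp only [hbj, Fin.sum_univ_six]
      fin_cases j
      all_goals simp [cyclotomicSevenCompanion, ← pow_succ']
      · ring
      · simp only [Finset.sum_range_succ, Finset.sum_range_zero] at hgen
        linear_combination hgen
    ext i j
    rw [Algebra.leftMulMatrix_eq_repr_mul, key, b.repr_sum_self]
    rfl
  rw [Algebra.norm_eq_matrix_det b, ← aeval_algHom_apply, map_sub, map_one, hC, normForm,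
    uniformizerMatrix, map_sub, map_one]

end Norm

/-- `-1` is not a norm in the extension `ℚ(ω, ζ₇)/ℚ(ω)`: there is no
`a ∈ ℚ(ω, ζ₇)` with `N_{ℚ(ω,ζ₇)/ℚ(ω)}(a) = -1`. -/
theorem statement_10 (ω ζ : ℂ) (hω : IsPrimitiveRoot ω 3) (hζ : IsPrimitiveRoot ζ 7)
    (a : ℚ⟮ω⟯⟮ζ⟯) :
    Algebra.norm ℚ⟮ω⟯ a ≠ -1 := by
  obtain ⟨σ⟩ := exists_ringHom_padic hω
  have hirr : Irreducible (Polynomial.cyclotomic 7 ℚ⟮ω⟯) :=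
    (Polynomial.cyclotomic.monic 7 _).irreducible_of_irreducible_map σ _
      (by simpa using irreducible_cyclotomic_padic 7)
  have hmin := hζ.minpoly_eq_cyclotomic_of_irreducible hirr
  have hint : IsIntegral ℚ⟮ω⟯ ζ := (hζ.isIntegral (by norm_num)).tower_top
  set pb := adjoin.powerBasis hint
  have hpb : minpoly ℚ⟮ω⟯ pb.gen = Polynomial.cyclotomic 7 _ := by
    rw [adjoin.powerBasis_gen, minpoly_gen, hmin]
  obtain ⟨p, hp, rfl⟩ := pb.exists_eq_aeval a
  have hdim : pb.dim = 6 := by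
    rw [← pb.natDegree_minpoly, hpb, Polynomial.natDegree_cyclotomic, Nat.totient_prime Fact.out]
  have hp' : Polynomial.aeval pb.gen p =
      Polynomial.aeval (pb.gen - 1) (p.comp (Polynomial.X + 1)) := by
    simp [Polynomial.aeval_comp]
  rw [hp', norm_eq_normForm pb hpb]
  intro h
  refine padic_normForm_ne_neg_one (q := (p.comp (Polynomial.X + 1)).map σ) ?_ ?_
  · rw [Polynomial.natDegree_map, Polynomial.natDegree_comp, ← Polynomial.C_1,
      Polynomial.natDegree_X_add_C, mul_one, ← hdim]
    exact hp
  · rw [normForm_map, h, map_neg, map_one]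
end
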